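/- Let g, h be 3-Lie algebras over a field K of characteristic 0 and (ρ,ν,ω) extension data such that (g⊕h, [·,·,·]_{(ρ,ν,ω)}) is a 3-Lie algebra, with fundamental bracket [·,·]_F̂ on ∧²(g⊕h). Let ι: (∧²h)⊕(g⊗h) → ∧²(g⊕h) be the canonical embedding determined by ι(u∧v) = u∧v and ι(x⊗w) = x∧w (u,v,w ∈ h, x ∈ g). Then ι is injective, its image is a Leibniz subalgebra of (∧²(g⊕h), [·,·]_F̂), and [ι(a), ι(b)]_F̂ = ι({a,b}) for all a,b ∈ (∧²h)⊕(g⊗h), where {·,·} is the bracket {u1∧v1 + x1⊗w1, u2∧v2 + x2⊗w2} = [u1,v1,u2]_h∧v2 + u2∧[u1,v1,v2]_h + ν(x2)(u1,v1)∧w2 + x2⊗[u1,v1,w2]_h + ν(x1)(w1,u2)∧v2 + u2∧ν(x1)(w1,v2) − ρ(x1,x2)(w1)∧w2 + x2⊗ν(x1)(w1,w2). -/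

import Mathlib

open scoped TensorProduct

section

variable {K : Type*} [Field K]
variable {g h : Type*} [AddCommGroup g] [Module K g] [AddCommGroup h] [Module K h]

/-- The bracket `[·,·,·]_{(ρ,ν,ω)}` on `g ⊕ h` built from extension data. -/
def extBracket (bg : g →ₗ[K] g →ₗ[K] g →ₗ[K] g) (bh : h →ₗ[K] h →ₗ[K] h →ₗ[K] h)
    (ρ : g →ₗ[K] g →ₗ[K] Module.End K h)
    (ν : g →ₗ[K] h →ₗ[K] h →ₗ[K] h)
    (ω : g →ₗ[K] g →ₗ[K] g →ₗ[K] h) :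
    g × h → g × h → g × h → g × h :=
  fun a b c =>
    (bg a.1 b.1 c.1,
      ω a.1 b.1 c.1 + ρ a.1 b.1 c.2 + ρ b.1 c.1 a.2 + ρ c.1 a.1 b.2
        + ν a.1 b.2 c.2 + ν b.1 c.2 a.2 + ν c.1 a.2 b.2 + bh a.2 b.2 c.2)

end

/-- The simple wedge `x ∧ y` in the second exterior power `⋀[K]^2 g`. -/
noncomputable def wedge2 (K : Type*) [Field K] {g : Type*} [AddCommGroup g] [Module K g]
    (x y : g) : ⋀[K]^2 g :=
  ⟨ExteriorAlgebra.ιMulti K 2 ![x, y], ExteriorAlgebra.ιMulti_range K 2 (Set.mem_range_self _)⟩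

section

variable {K : Type*} [Field K]
variable {V W M : Type*} [AddCommGroup V] [Module K V] [AddCommGroup W] [Module K W]
variable [AddCommGroup M] [Module K M]

theorem wedge2_eq_ιMulti (x y : V) : wedge2 K x y = exteriorPower.ιMulti K 2 ![x, y] := rfl

theorem wedge2_zero_left (y : V) : wedge2 K 0 y = 0 :=
  (exteriorPower.ιMulti K 2).map_coord_zero (m := ![0, y]) 0 rfl

theorem wedge2_add_left (x x' y : V) : wedge2 K (x + x') y = wedge2 K x y + wedge2 K x' y := by
  simpa [wedge2_eq_ιMulti] using (exteriorPower.ιMulti K 2).map_vecCons_add ![y] x x'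

theorem wedge2_neg_left (x y : V) : wedge2 K (-x) y = -wedge2 K x y := by
  rw [eq_neg_iff_add_eq_zero, ← wedge2_add_left, neg_add_cancel, wedge2_zero_left]

theorem wedge2_swap (x y : V) : wedge2 K x y = -wedge2 K y x := by
  have := (exteriorPower.ιMulti K 2 (M := V)).map_swap ![y, x] (i := 0) (j := 1) (by decide)
  rw [wedge2_eq_ιMulti, wedge2_eq_ιMulti, ← this]
  congr 1
  ext i
  fin_cases i <;> rfl

theorem wedge2_add_right (x y y' : V) : wedge2 K x (y + y') = wedge2 K x y + wedge2 K x y' := by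
  rw [wedge2_swap, wedge2_add_left, neg_add, ← wedge2_swap, ← wedge2_swap]

theorem linearMap_ext_wedge2 {f f' : ⋀[K]^2 V →ₗ[K] M}
    (hf : ∀ u v, f (wedge2 K u v) = f' (wedge2 K u v)) : f = f' := by
  refine exteriorPower.linearMap_ext (AlternatingMap.ext fun m => ?_)
  have hm : m = ![m 0, m 1] := by
    ext i
    fin_cases i <;> rfl
  rw [hm]
  exact hf _ _

/-- Linear maps on `(⋀²W) × (V ⊗ W)` are determined by the pairs of a simple wedge and a simple
tensor. -/
theorem linearMap_ext_wedge2_tmul {f f' : (⋀[K]^2 W × (V ⊗[K] W)) →ₗ[K] M}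
    (hf : ∀ (u v : W) (x : V) (w : W),
      f (wedge2 K u v, x ⊗ₜ[K] w) = f' (wedge2 K u v, x ⊗ₜ[K] w)) : f = f' := by
  refine LinearMap.prod_ext (linearMap_ext_wedge2 fun u v => ?_) (TensorProduct.ext' fun x w => ?_)
  · simpa using hf u v 0 0
  · simpa [wedge2_zero_left] using hf 0 0 x w

/-- The projection `⋀²(V × W) → V ⊗ W`, `a ∧ b ↦ a.1 ⊗ b.2 - b.1 ⊗ a.2`. -/
noncomputable def wedge2ProdToTensor (K V W : Type*) [Field K] [AddCommGroup V] [Module K V]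
    [AddCommGroup W] [Module K W] : ⋀[K]^2 (V × W) →ₗ[K] V ⊗[K] W :=
  exteriorPower.alternatingMapLinearEquiv
    { toFun := fun m => (m 0).1 ⊗ₜ[K] (m 1).2 - (m 1).1 ⊗ₜ[K] (m 0).2
      map_update_add' := by
        intro _ m i x y
        fin_cases i <;> simp [TensorProduct.add_tmul, TensorProduct.tmul_add] <;> abel
      map_update_smul' := by
        intro _ m i c x
        fin_cases i <;> simp [TensorProduct.smul_tmul', smul_sub]
      map_eq_zero_of_eq' := by
        intro m i j hij hne
        fin_cases i <;> fin_cases j <;> simp_all }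

theorem wedge2ProdToTensor_wedge2 (a b : V × W) :
    wedge2ProdToTensor K V W (wedge2 K a b) = a.1 ⊗ₜ[K] b.2 - b.1 ⊗ₜ[K] a.2 :=
  exteriorPower.alternatingMapLinearEquiv_apply_ιMulti _ _

theorem map_wedge2 (f : V →ₗ[K] W) (x y : V) :
    exteriorPower.map 2 f (wedge2 K x y) = wedge2 K (f x) (f y) := by
  rw [wedge2_eq_ιMulti, exteriorPower.map_apply_ιMulti, wedge2_eq_ιMulti]
  congr 1
  ext i
  fin_cases i <;> rfl

end

/-- the canonical embedding `ι : (⋀²h) ⊕ (g ⊗ h) → ⋀²(g ⊕ h)` is injective,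
its image is a Leibniz subalgebra of `(⋀²(g⊕h), [·,·]_F̂)`, and `ι` intertwines the
fundamental bracket with the bracket `{·,·}`. -/
theorem embedding_fundamental_subalgebra {K : Type*} [Field K] [CharZero K]
    {g h : Type*} [AddCommGroup g] [Module K g] [AddCommGroup h] [Module K h]
    (bg : g →ₗ[K] g →ₗ[K] g →ₗ[K] g) (bh : h →ₗ[K] h →ₗ[K] h →ₗ[K] h)
    (hgalt : ∀ x y z : g, x = y ∨ y = z ∨ x = z → bg x y z = 0)
    (hgfi : ∀ x1 x2 x3 x4 x5 : g,
      bg x1 x2 (bg x3 x4 x5)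
        = bg (bg x1 x2 x3) x4 x5 + bg x3 (bg x1 x2 x4) x5 + bg x3 x4 (bg x1 x2 x5))
    (hhalt : ∀ u v w : h, u = v ∨ v = w ∨ u = w → bh u v w = 0)
    (hhfi : ∀ v1 v2 v3 v4 v5 : h,
      bh v1 v2 (bh v3 v4 v5)
        = bh (bh v1 v2 v3) v4 v5 + bh v3 (bh v1 v2 v4) v5 + bh v3 v4 (bh v1 v2 v5))
    (ρ : g →ₗ[K] g →ₗ[K] Module.End K h) (hρ : ∀ x y : g, ρ x y = - ρ y x)
    (ν : g →ₗ[K] h →ₗ[K] h →ₗ[K] h) (hν : ∀ (x : g) (u v : h), ν x u v = - ν x v u)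
    (ω : g →ₗ[K] g →ₗ[K] g →ₗ[K] h)
    (hω : ∀ x y z : g, x = y ∨ y = z ∨ x = z → ω x y z = 0)
    (healt : ∀ a b c : g × h, a = b ∨ b = c ∨ a = c → extBracket bg bh ρ ν ω a b c = 0)
    (hefi : ∀ a1 a2 a3 a4 a5 : g × h,
      extBracket bg bh ρ ν ω a1 a2 (extBracket bg bh ρ ν ω a3 a4 a5)
        = extBracket bg bh ρ ν ω (extBracket bg bh ρ ν ω a1 a2 a3) a4 a5
          + extBracket bg bh ρ ν ω a3 (extBracket bg bh ρ ν ω a1 a2 a4) a5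
          + extBracket bg bh ρ ν ω a3 a4 (extBracket bg bh ρ ν ω a1 a2 a5))
    -- the fundamental bracket on ⋀²(g⊕h):
    (F : ⋀[K]^2 (g × h) →ₗ[K] ⋀[K]^2 (g × h) →ₗ[K] ⋀[K]^2 (g × h))
    (hF : ∀ e1 e2 f1 f2 : g × h,
      F (wedge2 K e1 e2) (wedge2 K f1 f2)
        = wedge2 K (extBracket bg bh ρ ν ω e1 e2 f1) f2
          + wedge2 K f1 (extBracket bg bh ρ ν ω e1 e2 f2))
    -- the bracket {·,·} on (⋀²h) ⊕ (g ⊗ h):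
    (B : (⋀[K]^2 h × (g ⊗[K] h)) →ₗ[K] (⋀[K]^2 h × (g ⊗[K] h)) →ₗ[K]
          (⋀[K]^2 h × (g ⊗[K] h)))
    (hB : ∀ (u1 v1 u2 v2 w1 w2 : h) (x1 x2 : g),
      B (wedge2 K u1 v1, x1 ⊗ₜ[K] w1) (wedge2 K u2 v2, x2 ⊗ₜ[K] w2)
        = (wedge2 K (bh u1 v1 u2) v2 + wedge2 K u2 (bh u1 v1 v2)
            + wedge2 K (ν x2 u1 v1) w2 + wedge2 K (ν x1 w1 u2) v2
            + wedge2 K u2 (ν x1 w1 v2) - wedge2 K (ρ x1 x2 w1) w2,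
           x2 ⊗ₜ[K] (bh u1 v1 w2) + x2 ⊗ₜ[K] (ν x1 w1 w2)))
    -- the canonical embedding ι:
    (ι : (⋀[K]^2 h × (g ⊗[K] h)) →ₗ[K] ⋀[K]^2 (g × h))
    (hι1 : ∀ u v : h, ι (wedge2 K u v, 0) = wedge2 K ((0 : g), u) ((0 : g), v))
    (hι2 : ∀ (x : g) (w : h),
      ι (0, x ⊗ₜ[K] w) = wedge2 K (x, (0 : h)) ((0 : g), w)) :
    Function.Injective ι ∧
    (∀ X Y : ⋀[K]^2 (g × h),
      X ∈ LinearMap.range ι → Y ∈ LinearMap.range ι → F X Y ∈ LinearMap.range ι) ∧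
    (∀ a b : ⋀[K]^2 h × (g ⊗[K] h), F (ι a) (ι b) = ι (B a b)) := by
  have hι (u v : h) (x : g) (w : h) : ι (wedge2 K u v, x ⊗ₜ[K] w)
      = wedge2 K ((0 : g), u) ((0 : g), v) + wedge2 K (x, (0 : h)) ((0 : g), w) := by
    rw [← hι1, ← hι2, ← map_add, Prod.mk_add_mk, add_zero, zero_add]
  have hleft : ((exteriorPower.map 2 (LinearMap.snd K g h)).prod (wedge2ProdToTensor K g h)) ∘ₗ ι
      = LinearMap.id := by
    refine linearMap_ext_wedge2_tmul fun u v x w => ?_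
    simp [hι, map_wedge2, wedge2ProdToTensor_wedge2, wedge2_zero_left]
  have hbracket : F.compl₁₂ ι ι = B.compr₂ ι := by
    refine linearMap_ext_wedge2_tmul fun u1 v1 x1 w1 =>
      linearMap_ext_wedge2_tmul fun u2 v2 x2 w2 => ?_
    have hinr (u v : h) : ((0 : g), u + v) = (0, u) + (0, v) := by simp
    have hinr_neg (u : h) : ((0 : g), -u) = -(0, u) := by simp
    have hB' := hB u1 v1 u2 v2 w1 w2 x1 x2
    rw [← TensorProduct.tmul_add] at hB'
    have hsplit (p : ⋀[K]^2 h) (t : g ⊗[K] h) : ι (p, t) = ι (p, 0) + ι (0, t) := by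
      rw [← map_add, Prod.mk_add_mk, add_zero, zero_add]
    have hadd (p q : ⋀[K]^2 h) : ι (p + q, 0) = ι (p, 0) + ι (q, 0) := by
      rw [← map_add, Prod.mk_add_mk, add_zero]
    have hsub (p q : ⋀[K]^2 h) : ι (p - q, 0) = ι (p, 0) - ι (q, 0) := by
      rw [← map_sub, Prod.mk_sub_mk, sub_zero]
    rw [LinearMap.compl₁₂_apply, LinearMap.compr₂_apply, hB', hι, hι]
    rw [hsplit, hsub, hadd, hadd, hadd, hadd]
    simp only [hι1, hι2, map_add, LinearMap.add_apply, hF, extBracket]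
    simp [-Prod.mk_add_mk, -Prod.neg_mk, hρ x2 x1, hinr, hinr_neg, wedge2_add_right,
      wedge2_neg_left]
    abel
  have hFB (a b : ⋀[K]^2 h × (g ⊗[K] h)) : F (ι a) (ι b) = ι (B a b) :=
    LinearMap.congr_fun₂ hbracket a b
  refine ⟨LinearMap.injective_of_comp_eq_id _ _ hleft, ?_, hFB⟩
  rintro _ _ ⟨a, rfl⟩ ⟨b, rfl⟩
  exact ⟨B a b, (hFB a b).symm⟩
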